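/- Every finite triangle-free simple graph G with n ≥ 1 vertices and m edges contains an independent set of size at least n·f(2m/n), i.e., of size at least ((1−d̄) + d̄·ln d̄)/(d̄−1)²·n where d̄ = 2m/n is the average degree (with the convention that f is continuously extended at d̄ ∈ {0,1}). -/

import Mathlib

open Finset

/-- The Shearer function: `f x = ((1-x) + x·ln x)/(x-1)²` for `x ∈ (0,∞)\{1}`,
`f 1 = 1/2`, and `f x = 1` for `x ≤ 0`. -/
noncomputable def shearerF (x : ℝ) : ℝ :=
  if x ≤ 0 then 1
  else if x = 1 then 1 / 2
  else ((1 - x) + x * Real.log x) / (x - 1) ^ 2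

/-- `I` is an independent set of `G`: no two of its vertices are adjacent. -/
def IsIndepFinset {V : Type*} (G : SimpleGraph V) (I : Finset V) : Prop :=
  ∀ u ∈ I, ∀ v ∈ I, ¬ G.Adj u v


namespace ShearerAux

lemma D_pos {x t : ℝ} (hx : 0 < x) (ht : t ∈ Set.Icc (0:ℝ) 1) : 0 < 1 - t + x * t := by
  obtain ⟨h0, h1⟩ := ht
  rcases eq_or_lt_of_le h0 with h | h
  · rw [← h]; norm_num
  · have := mul_pos hx h; linarith

lemma int_h {x : ℝ} (hx : 0 < x) :
    IntervalIntegrable (fun t : ℝ => (1 - t) / (1 - t + x * t)) MeasureTheory.volume 0 1 := by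
  apply ContinuousOn.intervalIntegrable
  rw [Set.uIcc_of_le zero_le_one]
  apply ContinuousOn.div (by fun_prop) (by fun_prop)
  intro t ht; exact (D_pos hx ht).ne'

lemma int_g {x : ℝ} (hx : 0 < x) :
    IntervalIntegrable (fun t : ℝ => -(t * (1 - t) / (1 - t + x * t) ^ 2))
      MeasureTheory.volume 0 1 := by
  apply ContinuousOn.intervalIntegrable
  rw [Set.uIcc_of_le zero_le_one]
  apply ContinuousOn.neg
  apply ContinuousOn.div (by fun_prop) (by fun_prop)
  intro t ht; exact (pow_pos (D_pos hx ht) 2).ne'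

lemma f_eq {x : ℝ} (hx : 0 < x) :
    shearerF x = ∫ t in (0:ℝ)..1, (1 - t) / (1 - t + x * t) := by
  unfold shearerF
  rw [if_neg (not_le.mpr hx)]
  split_ifs with h1
  · subst h1
    have : ∀ t : ℝ, (1 - t) / (1 - t + 1 * t) = 1 - t := by
      intro t; rw [show 1 - t + 1 * t = 1 by ring, div_one]
    simp_rw [this]
    rw [intervalIntegral.integral_sub (by simp) (by simp)]
    simp; norm_num
  · have ha : x - 1 ≠ 0 := sub_ne_zero.mpr h1
    rw [intervalIntegral.integral_eq_sub_of_hasDerivAt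
      (f := fun t => -t / (x - 1) + x / (x - 1) ^ 2 * Real.log (1 - t + x * t)) _ (int_h hx)]
    · simp
      field_simp
      ring
    · intro t ht
      rw [Set.uIcc_of_le zero_le_one] at ht
      have hD := D_pos hx ht
      have h2 : HasDerivAt (fun t : ℝ => 1 - t + x * t) (-1 + x * 1) t := by
        have := ((hasDerivAt_id t).const_sub 1).add ((hasDerivAt_id t).const_mul x)
        exact this
      have h3 := ((hasDerivAt_id t).neg.div_const (x - 1)).add
        ((h2.log hD.ne').const_mul (x / (x - 1) ^ 2))
      refine HasDerivAt.congr_deriv (f := fun t => -t / (x - 1) + x / (x - 1) ^ 2 * Real.log (1 - t + x * t)) h3 ?_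
      obtain ⟨D, hDD⟩ : ∃ D, D = 1 - t + x * t := ⟨_, rfl⟩
      rw [← hDD] at hD ⊢
      have hD' := hD.ne'
      field_simp
      rw [hDD]
      ring

/-- slope -/
noncomputable def g (x : ℝ) : ℝ := ∫ t in (0:ℝ)..1, -(t * (1 - t) / (1 - t + x * t) ^ 2)

lemma g_nonpos {x : ℝ} (hx : 0 < x) : g x ≤ 0 := by
  unfold g
  rw [intervalIntegral.integral_neg, neg_nonpos]
  apply intervalIntegral.integral_nonneg zero_le_one
  intro t ht
  have := D_pos hx ht
  have h1 : 0 ≤ 1 - t := by linarith [ht.2]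
  have h0 := ht.1
  positivity

lemma ode {x : ℝ} (hx : 0 < x) : (x + 1) * shearerF x + (x ^ 2 - x) * g x = 1 := by
  rw [f_eq hx, g, ← intervalIntegral.integral_const_mul, ← intervalIntegral.integral_const_mul,
    ← intervalIntegral.integral_add ((int_h hx).const_mul _) ((int_g hx).const_mul _)]
  rw [intervalIntegral.integral_eq_sub_of_hasDerivAt
      (f := fun t => ((x + 1) * t - t ^ 2) / (1 - t + x * t)) _
      (((int_h hx).const_mul _).add ((int_g hx).const_mul _))]
  · simp [hx.ne']
  · intro t ht
    rw [Set.uIcc_of_le zero_le_one] at ht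
    have hD := D_pos hx ht
    have h2 : HasDerivAt (fun t : ℝ => 1 - t + x * t) (-1 + x * 1) t :=
      ((hasDerivAt_id t).const_sub 1).add ((hasDerivAt_id t).const_mul x)
    have h3 : HasDerivAt (fun t : ℝ => (x + 1) * t - t ^ 2) ((x + 1) * 1 - 2 * t) t := by
      have := ((hasDerivAt_id t).const_mul (x + 1)).sub (hasDerivAt_pow 2 t)
      refine HasDerivAt.congr_deriv (f := fun t : ℝ => (x + 1) * t - t ^ 2) this ?_
      norm_num
    refine HasDerivAt.congr_deriv (f := fun t => ((x + 1) * t - t ^ 2) / (1 - t + x * t))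
      (h3.div h2 hD.ne') ?_
    obtain ⟨D, hDD⟩ : ∃ D, D = 1 - t + x * t := ⟨_, rfl⟩
    rw [← hDD] at hD ⊢
    have hD' := hD.ne'
    field_simp
    rw [hDD]
    ring

lemma tangent {x y : ℝ} (hx : 0 < x) (hy : 0 ≤ y) :
    shearerF x + g x * (y - x) ≤ shearerF y := by
  have key : shearerF x + g x * (y - x) = ∫ t in (0:ℝ)..1, ((1 - t) / (1 - t + x * t)
      + -(t * (1 - t) / (1 - t + x * t) ^ 2) * (y - x)) := by
    rw [f_eq hx, g, ← intervalIntegral.integral_mul_const,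
      ← intervalIntegral.integral_add (int_h hx) ((int_g hx).mul_const _)]
  rw [key]
  rcases eq_or_lt_of_le hy with h | h
  · subst h
    have : shearerF 0 = ∫ t in (0:ℝ)..1, (1:ℝ) := by simp [shearerF]
    rw [this]
    apply intervalIntegral.integral_mono_on zero_le_one
      ((int_h hx).add ((int_g hx).mul_const _)) (by simp)
    intro t ht
    have hD := D_pos hx ht
    have : (1 - t) / (1 - t + x * t) + -(t * (1 - t) / (1 - t + x * t) ^ 2) * (0 - x)
        = 1 - (t * x / (1 - t + x * t)) ^ 2 := by
      obtain ⟨D, hDD⟩ : ∃ D, D = 1 - t + x * t := ⟨_, rfl⟩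
      rw [← hDD] at hD ⊢
      have := hD.ne'
      field_simp
      rw [hDD]
      ring
    rw [this]
    linarith [sq_nonneg (t * x / (1 - t + x * t))]
  · rw [f_eq h]
    apply intervalIntegral.integral_mono_on zero_le_one
      ((int_h hx).add ((int_g hx).mul_const _)) (int_h h)
    intro t ht
    have hD := D_pos hx ht
    have hE := D_pos h ht
    have e : (1 - t) / (1 - t + y * t) - ((1 - t) / (1 - t + x * t)
        + -(t * (1 - t) / (1 - t + x * t) ^ 2) * (y - x))
        = (1 - t) * (t * (y - x)) ^ 2 / ((1 - t + y * t) * (1 - t + x * t) ^ 2) := by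
      obtain ⟨D, hDD⟩ : ∃ D, D = 1 - t + x * t := ⟨_, rfl⟩
      obtain ⟨D', hDD'⟩ : ∃ D, D = 1 - t + y * t := ⟨_, rfl⟩
      rw [← hDD] at hD ⊢
      rw [← hDD'] at hE ⊢
      have := hD.ne'
      have := hE.ne'
      field_simp
      rw [hDD, hDD']
      ring
    have h1 : 0 ≤ 1 - t := by linarith [ht.2]
    have : 0 ≤ (1 - t) * (t * (y - x)) ^ 2 / ((1 - t + y * t) * (1 - t + x * t) ^ 2) := by
      positivity
    linarith

section graph
variable {V : Type*} [Fintype V] [DecidableEq V] (G : SimpleGraph V) [DecidableRel G.Adj]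

/-- adjacency indicator -/
def A (u v : V) : ℝ := if G.Adj u v then 1 else 0

lemma A_comm (u v : V) : A G u v = A G v u := by simp [A, G.adj_comm]

/-- degree inside `S` -/
def dg (S : Finset V) (u : V) : ℝ := ∑ v ∈ S, A G u v

/-- twice the number of edges inside `S` -/
def E (S : Finset V) : ℝ := ∑ u ∈ S, dg G S u

/-- neighbours inside `S` -/
def N (S : Finset V) (v : V) : Finset V := S.filter (G.Adj v)

lemma A_nonneg (u v : V) : 0 ≤ A G u v := by unfold A; split_ifs <;> norm_num

lemma E_nonneg (S : Finset V) : 0 ≤ E G S :=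
  Finset.sum_nonneg fun _ _ => Finset.sum_nonneg fun _ _ => A_nonneg G _ _

lemma card_N (S : Finset V) (v : V) : ((N G S v).card : ℝ) = dg G S v := by
  simp [N, dg, A]

lemma sum_N (S : Finset V) (v : V) (F : V → ℝ) : ∑ u ∈ N G S v, F u = ∑ u ∈ S, A G v u * F u := by
  simp [N, A, Finset.sum_filter]

lemma E_step (hG : G.CliqueFree 3) (S : Finset V) (v : V) :
    E G (S \ insert v (N G S v)) + 2 * ∑ u ∈ N G S v, dg G S u ≤ E G S := by
  set T := S \ insert v (N G S v) with hT
  have hTS : S.filter (· ∈ T) = T := by ext; simp [hT]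
  have hNS : S.filter (· ∈ N G S v) = N G S v := by ext; simp [N]
  have e1 : E G T = ∑ a ∈ S, ∑ b ∈ S, (if a ∈ T then if b ∈ T then A G a b else 0 else 0) := by
    unfold E dg
    conv_lhs => rw [← hTS]
    rw [Finset.sum_filter]
    refine Finset.sum_congr rfl fun a _ => ?_
    split_ifs
    · rw [Finset.sum_filter]
    · simp
  have e2 : ∑ u ∈ N G S v, dg G S u = ∑ a ∈ S, ∑ b ∈ S, (if a ∈ N G S v then A G a b else 0) := by
    unfold dg
    conv_lhs => rw [← hNS]
    rw [Finset.sum_filter]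
    refine Finset.sum_congr rfl fun a _ => ?_
    split_ifs
    · rfl
    · simp
  have e3 : ∑ u ∈ N G S v, dg G S u = ∑ a ∈ S, ∑ b ∈ S, (if b ∈ N G S v then A G a b else 0) := by
    rw [e2, Finset.sum_comm]
    refine Finset.sum_congr rfl fun a _ => Finset.sum_congr rfl fun b _ => ?_
    rw [A_comm]
  rw [two_mul, e1]
  nth_rewrite 1 [e2]
  rw [e3]
  simp_rw [← Finset.sum_add_distrib]
  unfold E dg
  refine Finset.sum_le_sum fun a _ => Finset.sum_le_sum fun b _ => ?_
  have hA := A_nonneg G a b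
  have d : ∀ c, c ∈ T → c ∉ N G S v := by
    intro c hc; simp only [hT, Finset.mem_sdiff, Finset.mem_insert] at hc; tauto
  have da := d a
  have db := d b
  have ind : a ∈ N G S v → b ∈ N G S v → A G a b = 0 := by
    intro ha hb
    simp only [N, Finset.mem_filter] at ha hb
    rw [A, if_neg]
    intro hab
    exact hG {v, a, b} (SimpleGraph.is3Clique_triple_iff.mpr ⟨ha.2, hb.2, hab⟩)
  clear_value T
  clear e1 e2 e3 hTS hNS hT d
  by_cases ha : a ∈ N G S v <;> by_cases hb : b ∈ N G S v
  · rw [ind ha hb]; simp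
  · have : a ∉ T := fun h => da h ha
    simp [this, ha, hb]
  · have : b ∉ T := fun h => db h hb
    simp [this, ha, hb]
  · simp only [ha, hb, if_false]
    split_ifs <;> linarith

lemma exists_good (S : Finset V) (hS : 0 < S.card) (hE : 0 < E G S) :
    ∃ v ∈ S, 0 ≤ 1 - (dg G S v + 1) * shearerF (E G S / S.card) + g (E G S / S.card) *
      ((dg G S v + 1) * (E G S / S.card) - 2 * ∑ u ∈ N G S v, dg G S u) := by
  have hn : (0:ℝ) < S.card := by exact_mod_cast hS
  set n : ℝ := (S.card : ℝ) with hn'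
  set x := E G S / n with hx
  have hx0 : 0 < x := div_pos hE hn
  have hEx : E G S = n * x := by rw [hx]; field_simp
  have hsum : ∑ v ∈ S, dg G S v = n * x := hEx
  have hone : ∑ v ∈ S, (1:ℝ) = n := by simp [hn']
  have hsq : ∑ v ∈ S, ∑ u ∈ N G S v, dg G S u = ∑ u ∈ S, dg G S u ^ 2 := by
    simp_rw [sum_N]
    rw [Finset.sum_comm]
    refine Finset.sum_congr rfl fun u _ => ?_
    rw [← Finset.sum_mul, sq]
    congr 1
    exact Finset.sum_congr rfl fun _ _ => A_comm G _ _
  have hcs : n * x ^ 2 ≤ ∑ u ∈ S, dg G S u ^ 2 := by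
    have := sq_sum_le_card_mul_sum_sq (s := S) (f := dg G S)
    rw [hsum, ← hn'] at this
    have h2 : n * (n * x ^ 2) ≤ n * ∑ u ∈ S, dg G S u ^ 2 := by nlinarith
    exact le_of_mul_le_mul_left h2 hn
  have hg := g_nonpos hx0
  have ho := ode hx0
  apply Finset.exists_le_of_sum_le (Finset.card_pos.mp hS)
  have tot : ∑ v ∈ S, (1 - (dg G S v + 1) * shearerF x + g x *
      ((dg G S v + 1) * x - 2 * ∑ u ∈ N G S v, dg G S u))
      = n - (n * x + n) * shearerF x + g x * ((n * x + n) * x - 2 * ∑ u ∈ S, dg G S u ^ 2) := by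
    rw [Finset.sum_add_distrib, Finset.sum_sub_distrib, ← Finset.sum_mul, ← Finset.mul_sum,
      Finset.sum_sub_distrib, ← Finset.sum_mul, ← Finset.mul_sum, Finset.sum_add_distrib,
      hsum, hone, hsq]
  rw [tot, Finset.sum_const_zero]
  have h1 : 0 ≤ (-g x) * (∑ u ∈ S, dg G S u ^ 2 - n * x ^ 2) :=
    mul_nonneg (by linarith) (by linarith)
  have h2 : n * ((x + 1) * shearerF x + (x ^ 2 - x) * g x) = n := by rw [ho, mul_one]
  nlinarith

lemma main (hG : G.CliqueFree 3) (S : Finset V) :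
    ∃ I ⊆ S, IsIndepFinset G I ∧ (S.card : ℝ) * shearerF (E G S / S.card) ≤ I.card := by
  induction S using Finset.strongInduction with
  | H S ih =>
  rcases S.eq_empty_or_nonempty with h | h
  · subst h; exact ⟨∅, subset_rfl, by simp [IsIndepFinset], by simp⟩
  rcases eq_or_lt_of_le (E_nonneg G S) with h0 | h0
  · refine ⟨S, subset_rfl, ?_, ?_⟩
    · intro u hu v hv huv
      have h1 := (Finset.sum_eq_zero_iff_of_nonneg
        (fun a _ => Finset.sum_nonneg fun b _ => A_nonneg G a b)).mp h0.symm u hu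
      have h2 := (Finset.sum_eq_zero_iff_of_nonneg (fun b _ => A_nonneg G u b)).mp h1 v hv
      simp [A, huv] at h2
    · rw [← h0]; simp [shearerF]
  have hc := Finset.card_pos.mpr h
  obtain ⟨v, hv, hgood⟩ := exists_good G S hc h0
  have hstep := E_step G hG S v
  have hvN : v ∉ N G S v := by simp [N]
  have hsub : insert v (N G S v) ⊆ S := by
    intro a; simp only [Finset.mem_insert, N, Finset.mem_filter]; rintro (rfl | h); exacts [hv, h.1]
  have hcard : (S.card : ℝ) = (S \ insert v (N G S v)).card + (dg G S v + 1) := by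
    rw [← Finset.card_sdiff_add_card_eq_card hsub, Finset.card_insert_of_notMem hvN, ← card_N]
    push_cast; ring
  have hss : S \ insert v (N G S v) ⊂ S :=
    Finset.sdiff_ssubset hsub (Finset.insert_nonempty _ _)
  obtain ⟨I, hIS, hI, hIc⟩ := ih _ hss
  set T := S \ insert v (N G S v) with hT
  have hnadj : ∀ u ∈ I, ¬ G.Adj v u := by
    intro u hu hvu
    have := hIS hu
    simp [hT, N] at this
    tauto
  have hvI : v ∉ I := fun hh => by
    have := hIS hh
    simp [hT] at this
  refine ⟨insert v I, ?_, ?_, ?_⟩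
  · exact Finset.insert_subset hv (hIS.trans hss.1)
  · intro a ha b hb hab
    rw [Finset.mem_insert] at ha hb
    rcases ha with rfl | ha <;> rcases hb with rfl | hb
    · exact G.loopless.irrefl _ hab
    · exact hnadj b hb hab
    · exact hnadj a ha hab.symm
    · exact hI a ha b hb hab
  · rw [Finset.card_insert_of_notMem hvI]
    push_cast
    have hn : (0:ℝ) < S.card := by exact_mod_cast hc
    set n : ℝ := (S.card : ℝ)
    set x := E G S / n with hx
    have hx0 : 0 < x := div_pos h0 hn
    have hEx : E G S = n * x := by rw [hx]; field_simp
    have hg := g_nonpos hx0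
    have ht : (T.card : ℝ) * shearerF x + g x * (E G T - T.card * x)
        ≤ T.card * shearerF (E G T / T.card) := by
      have tg := tangent hx0 (div_nonneg (E_nonneg G T) (Nat.cast_nonneg T.card))
      have := mul_le_mul_of_nonneg_left tg (Nat.cast_nonneg (α := ℝ) T.card)
      rcases T.eq_empty_or_nonempty with hTe | hTe
      · rw [hTe]; simp [E]
      · have : (T.card : ℝ) ≠ 0 := by
          exact_mod_cast (Finset.card_pos.mpr hTe).ne'
        have e : (T.card : ℝ) * (E G T / T.card) = E G T := by field_simp
        calc _ = (T.card : ℝ) * (shearerF x + g x * (E G T / T.card - x)) := by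
              linear_combination (-g x) * e
          _ ≤ _ := by assumption
    have h3 := mul_nonneg (neg_nonneg.mpr hg) (sub_nonneg.mpr hstep)
    have hTc : (T.card : ℝ) = n - (dg G S v + 1) := by linarith
    rw [hTc] at ht hIc
    rw [hEx] at h3
    nlinarith

lemma E_univ : E G Finset.univ = 2 * (G.edgeFinset.card : ℝ) := by
  have := G.sum_degrees_eq_twice_card_edges
  have h : ((∑ v, G.degree v : ℕ) : ℝ) = 2 * (G.edgeFinset.card : ℝ) := by rw [this]; push_cast; rfl
  rw [← h]
  push_cast
  refine Finset.sum_congr rfl fun v _ => ?_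
  rw [← card_N, ← SimpleGraph.card_neighborFinset_eq_degree]
  congr 2
  ext; simp [N]

end graph
end ShearerAux

/-- Shearer's average-degree bound: every finite triangle-free graph
with `n ≥ 1` vertices and `m` edges contains an independent set of size at least
`n·f(2m/n)`, where `2m/n` is the average degree. -/
theorem shearer_average_degree_bound {V : Type*} [Fintype V] [DecidableEq V]
    [Nonempty V] (G : SimpleGraph V) [DecidableRel G.Adj] (hG : G.CliqueFree 3) :
    ∃ I : Finset V, IsIndepFinset G I ∧
      (Fintype.card V : ℝ) *
          shearerF (2 * (G.edgeFinset.card : ℝ) / (Fintype.card V : ℝ)) ≤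
        (I.card : ℝ) := by
  obtain ⟨I, -, hI, h⟩ := ShearerAux.main G hG Finset.univ
  rw [ShearerAux.E_univ, Finset.card_univ] at h
  exact ⟨I, hI, h⟩
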